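/- Let (X,d) be a metric space, α ∈ (0,1], and κ > 0. Let 𝒞_κ be the set of all bounded continuous functions g : X → ℝ such that inf_X g > 0 and v_α(g) ≤ κ·inf_X g. Let μ be a linear functional on the space of bounded continuous real-valued functions on X such that μ(g) ≥ 0 for every g ∈ 𝒞_κ. Then for every bounded continuous h : X → ℝ with finite α-Hölder seminorm v_α(h), one has |μ(h)| ≤ ((1+κ)/κ)·(sup_X|h| + v_α(h))·μ(1), where 1 denotes the constant function one. -/

import Mathlib

open scoped BoundedContinuousFunction

/-- The α-Hölder seminorm of `h`, defined as the least nonnegative constant `C`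
with `|h x - h x'| ≤ C · d(x,x')^α` (junk value `0` if no such constant exists). -/
noncomputable def vHolder {X : Type*} [PseudoMetricSpace X] (α : ℝ) (h : X → ℝ) : ℝ :=
  sInf {C : ℝ | 0 ≤ C ∧ ∀ x x', |h x - h x'| ≤ C * dist x x' ^ α}

theorem vHolder_nonneg {X : Type*} [PseudoMetricSpace X] (α : ℝ) (h : X → ℝ) :
    0 ≤ vHolder α h :=
  Real.sInf_nonneg fun _ hC => hC.1

/-- The infimum defining the Hölder seminorm is attained. -/
theorem abs_sub_le_vHolder_mul {X : Type*} [PseudoMetricSpace X] {α : ℝ} {h : X → ℝ}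
    (hh : ∃ C : ℝ, 0 ≤ C ∧ ∀ x x', |h x - h x'| ≤ C * dist x x' ^ α) (x x' : X) :
    |h x - h x'| ≤ vHolder α h * dist x x' ^ α := by
  rcases (Real.rpow_nonneg (dist_nonneg (x := x) (y := x')) α).eq_or_lt with hd | hd
  · obtain ⟨C, -, hC⟩ := hh
    simpa [← hd] using hC x x'
  · rw [← div_le_iff₀ hd]
    exact le_csInf hh fun C hC => (div_le_iff₀ hd).2 (hC.2 x x')

/-- A functional that is nonnegative on the cone is nonnegative on `(1 + κ) / κ * (N + V) + k`
whenever `k` has sup norm at most `N` and Hölder constant at most `V`. -/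
theorem nonneg_map_const_add {X : Type*} [PseudoMetricSpace X] [Nonempty X]
    {α κ : ℝ} (hκ : 0 < κ) {μ : (X →ᵇ ℝ) →ₗ[ℝ] ℝ}
    (hμ : ∀ g : X →ᵇ ℝ, (0 < ⨅ x, g x) →
      (∀ x x', |g x - g x'| ≤ (κ * ⨅ y, g y) * dist x x' ^ α) → 0 ≤ μ g)
    {k : X →ᵇ ℝ} {N V : ℝ} (hV : 0 ≤ V) (hNV : 0 < N + V) (hk : ‖k‖ ≤ N)
    (hkV : ∀ x x', |k x - k x'| ≤ V * dist x x' ^ α) :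
    0 ≤ (1 + κ) / κ * (N + V) * μ 1 + μ k := by
  set T := (1 + κ) / κ * (N + V) with hT
  have hTN : T - N = (N + V) / κ + V := by rw [hT]; field_simp; ring
  have hinf : T - N ≤ ⨅ x, (T • (1 : X →ᵇ ℝ) + k) x := by
    refine le_ciInf fun x => ?_
    have hkx := (abs_le.1 ((k.norm_coe_le_norm x).trans hk)).1
    simp only [BoundedContinuousFunction.coe_add, BoundedContinuousFunction.coe_smul,
      BoundedContinuousFunction.coe_one, Pi.add_apply, Pi.one_apply, smul_eq_mul, mul_one]
    linarith
  have hpos : 0 < T - N := by rw [hTN]; positivity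
  have hVκ : V ≤ κ * (T - N) := by
    have hN : 0 ≤ N := (norm_nonneg k).trans hk
    rw [hTN, mul_add, mul_div_cancel₀ _ hκ.ne']
    linarith [mul_nonneg hκ.le hV]
  have key := hμ (T • 1 + k) (hpos.trans_le hinf) fun x x' => by
    have hle : V ≤ κ * ⨅ x, (T • (1 : X →ᵇ ℝ) + k) x :=
      hVκ.trans (mul_le_mul_of_nonneg_left hinf hκ.le)
    simpa using (hkV x x').trans
      (mul_le_mul_of_nonneg_right hle (Real.rpow_nonneg dist_nonneg α))
  rwa [map_add, map_smul, smul_eq_mul] at key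

/-- bounded aperture of the dual of the cone
`𝒞_κ = {g : inf g > 0, v_α(g) ≤ κ · inf g}`. -/
theorem stmt_11 {X : Type*} [MetricSpace X] [Nonempty X]
    (α : ℝ) (hα : α ∈ Set.Ioc (0 : ℝ) 1) (κ : ℝ) (hκ : 0 < κ)
    (μ : (X →ᵇ ℝ) →ₗ[ℝ] ℝ)
    (hμ : ∀ g : X →ᵇ ℝ, (0 < ⨅ x, g x) →
      (∀ x x', |g x - g x'| ≤ (κ * ⨅ y, g y) * dist x x' ^ α) → 0 ≤ μ g)
    (h : X →ᵇ ℝ)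
    (hh : ∃ C : ℝ, 0 ≤ C ∧ ∀ x x', |h x - h x'| ≤ C * dist x x' ^ α) :
    |μ h| ≤ (1 + κ) / κ * (‖h‖ + vHolder α (fun x => h x)) * μ 1 := by
  have hV := vHolder_nonneg α (fun x => h x)
  have hhV := abs_sub_le_vHolder_mul hh
  rcases (add_nonneg (norm_nonneg h) hV).eq_or_lt with hM | hM
  · have h0 : h = 0 := norm_eq_zero.1 (by linarith [norm_nonneg h])
    rw [← hM, h0]
    simp
  · have hadd := nonneg_map_const_add hκ hμ hV hM le_rfl hhV
    have hsub := nonneg_map_const_add hκ hμ (k := -h) hV hM (norm_neg h).le fun x x' => by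
      simpa [abs_sub_comm, dist_comm, neg_add_eq_sub] using hhV x' x
    rw [map_neg] at hsub
    exact abs_le.2 ⟨by linarith, by linarith⟩
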